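/- There are exactly 96 three-element subsets S of Φ₁ that are A₃-subsets, i.e., whose elements can be ordered as (u,v,w) with ⟪u,v⟫ = −1, ⟪v,w⟫ = −1 and ⟪u,w⟫ = 0. -/

import Mathlib

open scoped RealInnerProductSpace

/-- The Euclidean space `ℝ⁴`. -/
abbrev E4 : Type := EuclideanSpace ℝ (Fin 4)

/-- The standard basis vector `eᵢ` of `ℝ⁴`. -/
noncomputable def ev (i : Fin 4) : E4 := EuclideanSpace.single i 1

/-- The 16-element set `Φ₁ = {s•eₐ + t•e_b : s,t ∈ {1,−1}, a ∈ {0,1}, b ∈ {2,3}}`. -/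
def Phi1 : Set E4 :=
  {v | ∃ s t : ℝ, ∃ a b : Fin 4, (s = 1 ∨ s = -1) ∧ (t = 1 ∨ t = -1) ∧
    (a = 0 ∨ a = 1) ∧ (b = 2 ∨ b = 3) ∧ v = s • ev a + t • ev b}

/-- A three-element subset `S ⊆ Φ₁` is an `A₃`-subset if its elements can be ordered as
`(u,v,w)` with `⟪u,v⟫ = −1`, `⟪v,w⟫ = −1` and `⟪u,w⟫ = 0`. -/
def IsA3Subset (S : Set E4) : Prop :=
  S ⊆ Phi1 ∧ S.ncard = 3 ∧
    ∃ u v w : E4, S = {u, v, w} ∧ ⟪u, v⟫ = -1 ∧ ⟪v, w⟫ = -1 ∧ ⟪u, w⟫ = 0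

/-- Labels `(a, b, s, t)` for the elements of `Φ₁`: two axes and two signs. -/
abbrev RootLabel : Type := Bool × Bool × Bool × Bool

/-- The sign encoded by a Boolean. -/
def boolSign (s : Bool) : ℤ := if s then 1 else -1

/-- The integer coordinates of the element of `Φ₁` with a given label. -/
def rootCoord (p : RootLabel) : Fin 4 → ℤ :=
  Pi.single (if p.1 then 1 else 0) (boolSign p.2.2.1) +
    Pi.single (if p.2.1 then 3 else 2) (boolSign p.2.2.2)

/-- The element of `Φ₁` with a given label. -/
noncomputable def rootVec (p : RootLabel) : E4 := WithLp.toLp 2 fun i => (rootCoord p i : ℝ)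

/-- Integer inner product of two labelled roots. -/
def rootInner (p q : RootLabel) : ℤ := ∑ i, rootCoord p i * rootCoord q i

lemma inner_rootVec (p q : RootLabel) : ⟪rootVec p, rootVec q⟫ = (rootInner p q : ℝ) := by
  simp [rootVec, rootInner, PiLp.inner_apply, mul_comm]

lemma rootVec_injective : Function.Injective rootVec := by
  have hc : Function.Injective rootCoord := by decide +kernel
  intro p q h
  apply hc
  funext i
  have := congrArg (fun x : E4 => x i) h
  simpa [rootVec] using this

lemma rootVec_eq (a b s t : Bool) : rootVec (a, b, s, t) =
    (boolSign s : ℝ) • ev (if a then 1 else 0) + (boolSign t : ℝ) • ev (if b then 3 else 2) := by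
  ext i
  cases a <;> cases b <;> fin_cases i <;> simp [rootVec, rootCoord, ev]

lemma range_rootVec : Set.range rootVec = Phi1 := by
  ext x
  constructor
  · rintro ⟨⟨a, b, s, t⟩, rfl⟩
    refine ⟨_, _, _, _, ?_, ?_, ?_, ?_, rootVec_eq a b s t⟩
    · cases s <;> simp [boolSign]
    · cases t <;> simp [boolSign]
    · cases a <;> simp
    · cases b <;> simp
  · rintro ⟨s, t, a, b, hs, ht, ha, hb, rfl⟩
    have sign {r : ℝ} (hr : r = 1 ∨ r = -1) : ∃ c : Bool, (boolSign c : ℝ) = r := by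
      rcases hr with rfl | rfl
      · exact ⟨true, by simp [boolSign]⟩
      · exact ⟨false, by simp [boolSign]⟩
    obtain ⟨s, rfl⟩ := sign hs
    obtain ⟨t, rfl⟩ := sign ht
    refine ⟨(decide (a = 1), decide (b = 3), s, t), ?_⟩
    rw [rootVec_eq]
    rcases ha with rfl | rfl <;> rcases hb with rfl | rfl <;> simp

/-- The label sets of the `A₃`-subsets of `Φ₁`. -/
def a3Labels : Finset (Finset RootLabel) :=
  (Finset.univ.powersetCard 3).filter fun S => ∃ u ∈ S, ∃ v ∈ S, rootInner u v = -1 ∧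
    ∃ w ∈ S, rootInner v w = -1 ∧ rootInner u w = 0 ∧ S = {u, v, w}

lemma card_a3Labels : a3Labels.card = 96 := by decide +kernel

lemma mem_a3Labels {S : Finset RootLabel} : S ∈ a3Labels ↔ S.card = 3 ∧
    ∃ u v w, S = {u, v, w} ∧ rootInner u v = -1 ∧ rootInner v w = -1 ∧ rootInner u w = 0 := by
  simp only [a3Labels, Finset.mem_filter, Finset.mem_powersetCard, Finset.subset_univ, true_and]
  refine and_congr_right fun _ => ⟨?_, ?_⟩
  · rintro ⟨u, -, v, -, huv, w, -, hvw, huw, h⟩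
    exact ⟨u, v, w, h, huv, hvw, huw⟩
  · rintro ⟨u, v, w, rfl, huv, hvw, huw⟩
    exact ⟨u, by simp, v, by simp, huv, w, by simp, hvw, huw, rfl⟩

lemma isA3Subset_iff_exists_label {S : Set E4} :
    IsA3Subset S ↔ ∃ T ∈ a3Labels, rootVec '' (T : Set RootLabel) = S := by
  constructor
  · rintro ⟨hS, hcard, u, v, w, rfl, huv, hvw, huw⟩
    rw [← range_rootVec] at hS
    obtain ⟨u, rfl⟩ := hS (show u ∈ _ by simp)
    obtain ⟨v, rfl⟩ := hS (show v ∈ _ by simp)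
    obtain ⟨w, rfl⟩ := hS (show w ∈ _ by simp)
    have himage : rootVec '' (({u, v, w} : Finset RootLabel) : Set RootLabel) =
        {rootVec u, rootVec v, rootVec w} := by
      simp [Set.image_insert_eq]
    rw [← himage, Set.ncard_image_of_injective _ rootVec_injective, Set.ncard_coe_finset] at hcard
    rw [inner_rootVec] at huv hvw huw
    exact ⟨_, mem_a3Labels.2 ⟨hcard, u, v, w, rfl, by exact_mod_cast huv, by exact_mod_cast hvw,
      by exact_mod_cast huw⟩, himage⟩
  · rintro ⟨T, hT, rfl⟩
    obtain ⟨hcard, u, v, w, h, huv, hvw, huw⟩ := mem_a3Labels.1 hT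
    refine ⟨range_rootVec ▸ Set.image_subset_range _ _, ?_, rootVec u, rootVec v, rootVec w,
      ?_, ?_, ?_, ?_⟩
    · rw [Set.ncard_image_of_injective _ rootVec_injective, Set.ncard_coe_finset, hcard]
    · simp [h, Set.image_insert_eq]
    all_goals rw [inner_rootVec]; simp [huv, hvw, huw]

/-- There are exactly 96 three-element subsets of `Φ₁` that are `A₃`-subsets. -/
theorem card_A3_subsets : Set.ncard {S : Set E4 | IsA3Subset S} = 96 := by
  have heq : {S : Set E4 | IsA3Subset S} =
      (fun T : Finset RootLabel => rootVec '' (T : Set RootLabel)) '' a3Labels :=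
    Set.ext fun _ => isA3Subset_iff_exists_label
  have hinj : Function.Injective
      fun T : Finset RootLabel => rootVec '' (T : Set RootLabel) :=
    rootVec_injective.image_injective.comp Finset.coe_injective
  rw [heq, Set.ncard_image_of_injective _ hinj, Set.ncard_coe_finset, card_a3Labels]
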